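/- Let n ≥ 1, X = {0, 1, …, n}³, h > 0, Q ⊆ X nonempty, q : Q → ℝ, and let F, F' : X → (0, ∞) satisfy F(x) ≥ F'(x) for all x ∈ X. If U and U' solve the discretized Eikonal system with speeds F and F' respectively (and the same Q, h, q), then U(x) ≤ U'(x) for all x ∈ X; i.e., a pointwise larger speed yields a pointwise smaller solution. -/

import Mathlib

/-- The grid X = {0, 1, …, n}³, represented as functions Fin 3 → Fin (n+1). -/
abbrev Grid (n : ℕ) := Fin 3 → Fin (n + 1)

/-- `y` is a grid neighbor of `x` along axis `a`: they agree in all other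
coordinates and differ by exactly 1 in coordinate `a`. -/
def AxisNbr {n : ℕ} (a : Fin 3) (x y : Grid n) : Prop :=
  (∀ b, b ≠ a → y b = x b) ∧ ((y a : ℤ) - (x a : ℤ)).natAbs = 1

/-- m_a(U, x): the minimum of U over the grid neighbors of x along axis a. -/
noncomputable def axMin {n : ℕ} (U : Grid n → ℝ) (x : Grid n) (a : Fin 3) : ℝ :=
  sInf {v | ∃ y : Grid n, AxisNbr a x y ∧ U y = v}

/-- U solves the discretized Eikonal system with stepsize `hs`, exit set `Q`,
exit penalty `q`, and speed `F`. -/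
def SolvesEikonal {n : ℕ} (hs : ℝ) (Q : Set (Grid n)) (q F U : Grid n → ℝ) : Prop :=
  (∀ x ∈ Q, U x = q x) ∧
  ∀ x : Grid n, x ∉ Q →
    ∑ a : Fin 3, max (U x - axMin U x a) 0 ^ 2 = hs ^ 2 / F x ^ 2

theorem exists_axisNbr {n : ℕ} (hn : 1 ≤ n) (x : Grid n) (a : Fin 3) :
    ∃ y, AxisNbr a x y := by
  have key : ∃ k : Fin (n + 1), ((k : ℤ) - (x a : ℤ)).natAbs = 1 := by
    by_cases h : (x a : ℕ) = 0
    · exact ⟨⟨1, by omega⟩, by simp [h]⟩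
    · have := (x a).isLt
      exact ⟨⟨(x a : ℕ) - 1, by omega⟩, by simp only; omega⟩
  obtain ⟨k, hk⟩ := key
  exact ⟨Function.update x a k, fun b hb => Function.update_of_ne hb _ _, by simpa using hk⟩

theorem finite_axisNbr_values {n : ℕ} (U : Grid n → ℝ) (x : Grid n) (a : Fin 3) :
    {v | ∃ y : Grid n, AxisNbr a x y ∧ U y = v}.Finite :=
  (Set.finite_range U).subset fun _ ⟨y, _, hy⟩ => ⟨y, hy⟩

theorem axMin_le {n : ℕ} (U : Grid n → ℝ) {x y : Grid n} {a : Fin 3} (h : AxisNbr a x y) :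
    axMin U x a ≤ U y :=
  csInf_le (finite_axisNbr_values U x a).bddBelow ⟨y, h, rfl⟩

theorem exists_axisNbr_eq_axMin {n : ℕ} (hn : 1 ≤ n) (U : Grid n → ℝ) (x : Grid n)
    (a : Fin 3) : ∃ y, AxisNbr a x y ∧ U y = axMin U x a := by
  obtain ⟨y, hy⟩ := exists_axisNbr hn x a
  have hne : {v | ∃ y : Grid n, AxisNbr a x y ∧ U y = v}.Nonempty := ⟨U y, y, hy, rfl⟩
  exact hne.csInf_mem (finite_axisNbr_values U x a)

/-- A pointwise larger speed yields a pointwise smaller solution: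
if F ≥ F' pointwise, then U ≤ U' pointwise. -/
theorem eikonal_antitone_in_speed (n : ℕ) (hn : 1 ≤ n) (hs : ℝ) (hhs : 0 < hs)
    (Q : Set (Grid n)) (hQ : Q.Nonempty) (q F F' U U' : Grid n → ℝ)
    (hF : ∀ x, 0 < F x) (hF' : ∀ x, 0 < F' x)
    (hFF' : ∀ x, F' x ≤ F x)
    (hU : SolvesEikonal hs Q q F U) (hU' : SolvesEikonal hs Q q F' U') :
    ∀ x : Grid n, U x ≤ U' x := by
  obtain ⟨x₀, hx₀⟩ := Finite.exists_max fun x => U x - U' x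
  by_contra! hneg
  obtain ⟨z, hz⟩ := hneg
  obtain ⟨x, hx, hmin⟩ := Set.exists_min_image {x | U x - U' x = U x₀ - U' x₀} U'
    (Set.toFinite _) ⟨x₀, rfl⟩
  simp only [Set.mem_ofPred_eq] at hx hmin
  have hmax : ∀ y, U y - U' y ≤ U x - U' x := fun y => (hx₀ y).trans_eq hx.symm
  have hxQ : x ∉ Q := fun h => by
    have := hmax z
    rw [hU.1 x h, hU'.1 x h] at this
    linarith
  have hle : ∀ a, U' x - axMin U' x a ≤ U x - axMin U x a := fun a => by
    obtain ⟨y, hy, hya⟩ := exists_axisNbr_eq_axMin hn U' x a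
    linarith [axMin_le U hy, hmax y]
  have hlt : ∀ a, 0 < U' x - axMin U' x a →
      U' x - axMin U' x a < U x - axMin U x a := fun a ha => by
    obtain ⟨y, hy, hya⟩ := exists_axisNbr_eq_axMin hn U' x a
    have hne : U y - U' y ≠ U x - U' x := fun h => by
      linarith [hmin y (h.trans hx)]
    linarith [axMin_le U hy, lt_of_le_of_ne (hmax y) hne]
  have e := hU.2 x hxQ
  have e' := hU'.2 x hxQ
  have hF'x := hF' x
  obtain ⟨a, ha⟩ : ∃ a, 0 < U' x - axMin U' x a := by
    by_contra! hcon
    have hzero : ∑ a : Fin 3, max (U' x - axMin U' x a) 0 ^ 2 = 0 :=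
      Finset.sum_eq_zero fun a _ => by simp [max_eq_right (hcon a)]
    have hpos : 0 < hs ^ 2 / F' x ^ 2 := by positivity
    linarith
  have hsum : ∑ a : Fin 3, max (U' x - axMin U' x a) 0 ^ 2 <
      ∑ a : Fin 3, max (U x - axMin U x a) 0 ^ 2 := by
    refine Finset.sum_lt_sum (fun b _ => ?_) ⟨a, Finset.mem_univ a, ?_⟩
    · exact pow_le_pow_left₀ (le_max_right _ _) (max_le_max_right 0 (hle b)) 2
    · rw [max_eq_left ha.le, max_eq_left (ha.trans (hlt a ha)).le]
      exact pow_lt_pow_left₀ (hlt a ha) ha.le two_ne_zero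
  have hspeed : hs ^ 2 / F x ^ 2 ≤ hs ^ 2 / F' x ^ 2 := by
    have := hFF' x
    gcongr
  linarith
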